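/- arXiv:1309.1776 — 6 statements merged into one kernel-verified Lean document; each statement's English description precedes it below -/
import Mathlib

section
/- Main Lemma for general (possibly nonabelian) normal subgroups. Let 𝒮 be a characteristic subgroup functor and let N, Q be groups. For i = 1,2, let G_i be a finite group given as an extension of N by Q via ι_i : N → G_i and π_i : G_i → Q, and assume that the range of ι_i equals 𝒮(G_i). Let s_i : Q → G_i be normalized sections with associated extension data (T_i, f_i). Then G₁ and G₂ are isomorphic as groups if and only if there exist α ∈ Aut(N), β ∈ Aut(Q) and t : Q → N with t(1) = 1 such that for all q ∈ Q and n ∈ N, T₁(q)(n) = α⁻¹( t(β(q)) · T₂(β(q))(α(n)) · t(β(q))⁻¹ ), and for all q₁, q₂ ∈ Q, f₁(q₁,q₂) = α⁻¹( t(β(q₁)) · T₂(β(q₁))(t(β(q₂))) · f₂(β(q₁),β(q₂)) · t(β(q₁)β(q₂))⁻¹ ). -/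
section GroupExtensionIso

variable {N Q G₁ G₂ : Type*} [Group N] [Group Q] [Group G₁] [Group G₂]

/-- An isomorphism of groups matching the ranges of two embeddings of `N` restricts to an
automorphism of `N`. -/
theorem exists_mulAut_of_map_range_eq {ι₁ : N →* G₁} {ι₂ : N →* G₂}
    (hι₁ : Function.Injective ι₁) (hι₂ : Function.Injective ι₂) (φ : G₁ ≃* G₂)
    (hφ : ι₁.range.map (φ : G₁ →* G₂) = ι₂.range) :
    ∃ α : MulAut N, ∀ n, ι₂ (α n) = φ (ι₁ n) := by
  refine ⟨(MonoidHom.ofInjective hι₁).trans ((φ.subgroupMap ι₁.range).trans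
    ((MulEquiv.subgroupCongr hφ).trans (MonoidHom.ofInjective hι₂).symm)), fun n => ?_⟩
  simp only [MulEquiv.trans_apply]
  rw [MonoidHom.apply_ofInjective_symm]
  rfl

/-- An isomorphism of groups matching the kernels of two surjections onto `Q` induces an
automorphism of `Q`. -/
theorem exists_mulAut_of_map_ker_eq {π₁ : G₁ →* Q} {π₂ : G₂ →* Q}
    (hπ₁ : Function.Surjective π₁) (hπ₂ : Function.Surjective π₂) (φ : G₁ ≃* G₂)
    (hφ : π₁.ker.map (φ : G₁ →* G₂) = π₂.ker) :
    ∃ β : MulAut Q, ∀ g, β (π₁ g) = π₂ (φ g) := by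
  refine ⟨(QuotientGroup.quotientKerEquivOfSurjective π₁ hπ₁).symm.trans
    ((QuotientGroup.congr _ _ φ hφ).trans
      (QuotientGroup.quotientKerEquivOfSurjective π₂ hπ₂)), fun g => ?_⟩
  have h : (QuotientGroup.quotientKerEquivOfSurjective π₁ hπ₁).symm (π₁ g) =
      (g : G₁ ⧸ π₁.ker) := by
    rw [MulEquiv.symm_apply_eq]
    rfl
  simp only [MulEquiv.trans_apply, h]
  rfl

/-- Two extensions of `N` by `Q` are isomorphic, compatibly with given automorphisms `α` of `N`
and `β` of `Q`, as soon as the second one has a lift `c` of `β` along which conjugation and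
multiplication are given by the `α`-transport of the extension data of the first one. -/
theorem nonempty_mulEquiv_of_lift {ι₁ : N →* G₁} {ι₂ : N →* G₂} {π₁ : G₁ →* Q} {π₂ : G₂ →* Q}
    (hι₁ : Function.Injective ι₁) (hι₂ : Function.Injective ι₂)
    (hrk₁ : ι₁.range = π₁.ker) (hrk₂ : ι₂.range = π₂.ker)
    {s : Q → G₁} (hs : ∀ q, π₁ (s q) = q) (hs1 : s 1 = 1)
    {T : Q → MulAut N} {f : Q → Q → N}
    (hT : ∀ q n, ι₁ (T q n) = s q * ι₁ n * (s q)⁻¹)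
    (hf : ∀ p q, ι₁ (f p q) = s p * s q * (s (p * q))⁻¹)
    (α : MulAut N) (β : MulAut Q) {c : Q → G₂} (hc : ∀ q, π₂ (c q) = β q) (hc1 : c 1 = 1)
    (hcT : ∀ q n, ι₂ (α (T q n)) = c q * ι₂ (α n) * (c q)⁻¹)
    (hcf : ∀ p q, ι₂ (α (f p q)) = c p * c q * (c (p * q))⁻¹) :
    Nonempty (G₁ ≃* G₂) := by
  have hπι₁ (n : N) : π₁ (ι₁ n) = 1 := by
    rw [← MonoidHom.mem_ker, ← hrk₁]
    exact ⟨n, rfl⟩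
  have hπι₂ (n : N) : π₂ (ι₂ n) = 1 := by
    rw [← MonoidHom.mem_ker, ← hrk₂]
    exact ⟨n, rfl⟩
  have hex (g : G₁) : ∃ n, ι₁ n = g * (s (π₁ g))⁻¹ := by
    have : g * (s (π₁ g))⁻¹ ∈ π₁.ker := by simp [MonoidHom.mem_ker, hs]
    rwa [← hrk₁] at this
  choose ν hν using hex
  have hνmul (g h : G₁) : ν (g * h) = ν g * T (π₁ g) (ν h) * f (π₁ g) (π₁ h) := by
    apply hι₁
    simp only [map_mul, hν, hT, hf]
    group
  let φ : G₁ →* G₂ := MonoidHom.mk' (fun g => ι₂ (α (ν g)) * c (π₁ g)) fun g h => by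
    simp only [hνmul, map_mul, hcT, hcf]
    group
  have hφ (g : G₁) : φ g = ι₂ (α (ν g)) * c (π₁ g) := rfl
  refine ⟨MulEquiv.ofBijective φ ⟨?_, fun h => ?_⟩⟩
  · rw [injective_iff_map_eq_one]
    intro g hg
    have hπg : π₁ g = 1 := by
      have := congrArg π₂ hg
      rw [hφ, map_mul, hπι₂, hc, one_mul, map_one] at this
      simpa using this
    rw [hφ, hπg, hc1, mul_one, map_eq_one_iff _ hι₂, EmbeddingLike.map_eq_one_iff] at hg
    have := hν g
    rw [hg, hπg, hs1] at this
    simpa using this.symm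
  · have hker : h * (c (β.symm (π₂ h)))⁻¹ ∈ π₂.ker := by
      simp [MonoidHom.mem_ker, hc]
    rw [← hrk₂] at hker
    obtain ⟨m, hm⟩ := hker
    refine ⟨ι₁ (α.symm m) * s (β.symm (π₂ h)), ?_⟩
    have hπ : π₁ (ι₁ (α.symm m) * s (β.symm (π₂ h))) = β.symm (π₂ h) := by
      rw [map_mul, hπι₁, hs, one_mul]
    have hn : ν (ι₁ (α.symm m) * s (β.symm (π₂ h))) = α.symm m := by
      apply hι₁
      rw [hν, hπ]
      group
    rw [hφ, hn, hπ, MulEquiv.apply_symm_apply, hm]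
    group

end GroupExtensionIso


/-- **Main Lemma for general (possibly nonabelian) normal subgroups.**
Let `S` be a characteristic subgroup functor and `N, Q` groups. For `i = 1,2`, let
`Gᵢ` be a finite group given as an extension of `N` by `Q` via `ιᵢ, πᵢ`, with the
range of `ιᵢ` equal to `S Gᵢ`, and let `sᵢ` be normalized sections with extension data
`(Tᵢ, fᵢ)`. Then `G₁ ≅ G₂` iff the extension data are pseudo-congruent. -/
theorem main_lemma_general
    (S : ∀ (G : Type) [Group G] [Finite G], Subgroup G)
    (hS : ∀ (H₁ H₂ : Type) [Group H₁] [Group H₂] [Finite H₁] [Finite H₂]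
      (φ : H₁ ≃* H₂), Subgroup.map (φ : H₁ →* H₂) (S H₁) = S H₂)
    (N : Type) [Group N] (Q : Type) [Group Q]
    (G₁ G₂ : Type) [Group G₁] [Group G₂] [Finite G₁] [Finite G₂]
    (ι₁ : N →* G₁) (ι₂ : N →* G₂) (π₁ : G₁ →* Q) (π₂ : G₂ →* Q)
    (hι₁ : Function.Injective ι₁) (hι₂ : Function.Injective ι₂)
    (hπ₁ : Function.Surjective π₁) (hπ₂ : Function.Surjective π₂)
    (hrk₁ : ι₁.range = π₁.ker) (hrk₂ : ι₂.range = π₂.ker)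
    (hS₁ : ι₁.range = S G₁) (hS₂ : ι₂.range = S G₂)
    (s₁ : Q → G₁) (s₂ : Q → G₂)
    (hs₁ : ∀ q, π₁ (s₁ q) = q) (hs₁1 : s₁ 1 = 1)
    (hs₂ : ∀ q, π₂ (s₂ q) = q) (hs₂1 : s₂ 1 = 1)
    (T₁ : Q → MulAut N) (T₂ : Q → MulAut N) (f₁ f₂ : Q → Q → N)
    (hT₁ : ∀ q n, ι₁ (T₁ q n) = s₁ q * ι₁ n * (s₁ q)⁻¹)
    (hT₂ : ∀ q n, ι₂ (T₂ q n) = s₂ q * ι₂ n * (s₂ q)⁻¹)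
    (hf₁ : ∀ p q, ι₁ (f₁ p q) = s₁ p * s₁ q * (s₁ (p * q))⁻¹)
    (hf₂ : ∀ p q, ι₂ (f₂ p q) = s₂ p * s₂ q * (s₂ (p * q))⁻¹) :
    Nonempty (G₁ ≃* G₂) ↔
      ∃ (α : MulAut N) (β : MulAut Q) (t : Q → N), t 1 = 1 ∧
        (∀ q n, T₁ q n = α.symm (t (β q) * T₂ (β q) (α n) * (t (β q))⁻¹)) ∧
        (∀ q₁ q₂, f₁ q₁ q₂ =
          α.symm (t (β q₁) * T₂ (β q₁) (t (β q₂)) * f₂ (β q₁) (β q₂)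
            * (t (β q₁ * β q₂))⁻¹)) := by
  constructor
  · rintro ⟨φ⟩
    have hrange : ι₁.range.map (φ : G₁ →* G₂) = ι₂.range := by
      rw [hS₁, hS₂]
      exact hS G₁ G₂ φ
    obtain ⟨α, hα⟩ := exists_mulAut_of_map_range_eq hι₁ hι₂ φ hrange
    obtain ⟨β, hβ⟩ := exists_mulAut_of_map_ker_eq hπ₁ hπ₂ φ (by rw [← hrk₁, ← hrk₂, hrange])
    have hex (q : Q) : ∃ n, ι₂ n = φ (s₁ (β.symm q)) * (s₂ q)⁻¹ := by
      have : φ (s₁ (β.symm q)) * (s₂ q)⁻¹ ∈ π₂.ker := by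
        rw [MonoidHom.mem_ker, map_mul, ← hβ, map_inv, hs₁, hs₂, MulEquiv.apply_symm_apply,
          mul_inv_cancel]
      rwa [← hrk₂] at this
    choose t ht using hex
    have htβ (q : Q) : ι₂ (t (β q)) = φ (s₁ q) * (s₂ (β q))⁻¹ := by
      rw [ht, MulEquiv.symm_apply_apply]
    refine ⟨α, β, t, ?_, fun q n => ?_, fun p q => ?_⟩
    · apply hι₂
      simp [ht, hs₁1, hs₂1]
    · rw [MulEquiv.eq_symm_apply]
      apply hι₂
      simp only [map_mul, map_inv, hα, hT₁, hT₂, htβ]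
      group
    · rw [MulEquiv.eq_symm_apply, ← map_mul β]
      apply hι₂
      rw [hα, hf₁]
      simp only [map_mul ι₂, map_inv, hT₂, hf₂, htβ, ← map_mul β]
      simp only [map_mul φ, map_inv]
      group
  · rintro ⟨α, β, t, ht1, hT, hf⟩
    have hπι₂ (n : N) : π₂ (ι₂ n) = 1 := by
      rw [← MonoidHom.mem_ker, ← hrk₂]
      exact ⟨n, rfl⟩
    refine nonempty_mulEquiv_of_lift hι₁ hι₂ hrk₁ hrk₂ hs₁ hs₁1 hT₁ hf₁ α β
      (c := fun q => ι₂ (t (β q)) * s₂ (β q)) (fun q => ?_) ?_ (fun q n => ?_) (fun p q => ?_)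
    · rw [map_mul, hπι₂, hs₂, one_mul]
    · simp [ht1, hs₂1]
    · rw [hT, MulEquiv.apply_symm_apply]
      simp only [map_mul, map_inv, hT₂]
      group
    · rw [hf, MulEquiv.apply_symm_apply]
      simp only [map_mul, map_inv, hT₂, hf₂]
      group
end

section
/- Central-product decomposition for extensions with trivial action (Lemma on trivial outer action). Let G be an extension of a group N by a group Q via ι : N → G and π : G → Q, and suppose there exists a normalized section s : Q → G such that s(q) ι(n) s(q)⁻¹ = ι(n) for all q ∈ Q and n ∈ N. Then the set H = { ι(z)·s(q) : z ∈ Z(N), q ∈ Q } is a subgroup of G; every element of H commutes with every element of ι(N); H ∩ ι(N) = ι(Z(N)); ι(N)·H = G; and the restriction of π to H is a surjective homomorphism onto Q whose kernel is ι(Z(N)), so that H is an extension of Z(N) by Q. Consequently G is the central product of ι(N) and H over ι(Z(N)). -/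
/-- An element of the range of an injective homomorphism centralizes that range if and only if it
is the image of a central element. -/
theorem MonoidHom.centralizer_range_inf_range {N G : Type*} [Group N] [Group G] (f : N →* G)
    (hf : Function.Injective f) :
    Subgroup.centralizer (f.range : Set G) ⊓ f.range = Subgroup.map f (Subgroup.center N) := by
  ext x
  simp only [Subgroup.mem_inf, Subgroup.mem_centralizer_iff, Subgroup.mem_map,
    Subgroup.mem_center_iff]
  constructor
  · rintro ⟨hx, z, rfl⟩
    exact ⟨z, fun n => hf (by simpa using hx (f n) ⟨n, rfl⟩), rfl⟩
  · rintro ⟨z, hz, rfl⟩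
    refine ⟨?_, z, rfl⟩
    rintro _ ⟨n, rfl⟩
    rw [← map_mul, ← map_mul, hz n]

/-- **Central-product decomposition for extensions with trivial action.**
Let `G` be an extension of `N` by `Q` via `ι, π`, and suppose there is a normalized
section `s` with `s q · ι n · (s q)⁻¹ = ι n` for all `q, n`. Then
`H = { ι z · s q : z ∈ Z(N), q ∈ Q }` is a subgroup of `G`, every element of `H`
commutes with every element of `ι(N)`, `H ⊓ ι(N) = ι(Z(N))`, `ι(N) · H = G`, and `π`
restricts to a surjection `H ↠ Q` with kernel `ι(Z(N))`, so `H` is an extension of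
`Z(N)` by `Q` and `G` is the central product of `ι(N)` and `H` over `ι(Z(N))`. -/
theorem trivial_outer_action_central_product
    (N : Type) [Group N] (Q : Type) [Group Q] (G : Type) [Group G]
    (ι : N →* G) (π : G →* Q)
    (hι : Function.Injective ι) (hπ : Function.Surjective π)
    (hrk : ι.range = π.ker)
    (s : Q → G) (hs : ∀ q, π (s q) = q) (hs1 : s 1 = 1)
    (htriv : ∀ q n, s q * ι n * (s q)⁻¹ = ι n) :
    ∃ H : Subgroup G,
      (H : Set G) = {x : G | ∃ z ∈ Subgroup.center N, ∃ q : Q, x = ι z * s q} ∧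
      (∀ h ∈ H, ∀ n : N, h * ι n = ι n * h) ∧
      H ⊓ ι.range = Subgroup.map ι (Subgroup.center N) ∧
      (∀ g : G, ∃ n : N, ∃ h ∈ H, g = ι n * h) ∧
      (∀ q : Q, ∃ h ∈ H, π h = q) ∧
      (∀ h ∈ H, (π h = 1 ↔ h ∈ Subgroup.map ι (Subgroup.center N))) := by
  have hsC : ∀ q, s q ∈ Subgroup.centralizer (ι.range : Set G) := by
    intro q
    rw [Subgroup.mem_centralizer_iff]
    rintro _ ⟨n, rfl⟩
    exact (mul_inv_eq_iff_eq_mul.mp (htriv q n)).symm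
  have hdecomp : ∀ g, ∃ n, g = ι n * s (π g) := by
    intro g
    have hg : g * (s (π g))⁻¹ ∈ ι.range := by
      rw [hrk, MonoidHom.mem_ker, map_mul, map_inv, hs, mul_inv_cancel]
    obtain ⟨n, hn⟩ := hg
    exact ⟨n, by rw [hn, inv_mul_cancel_right]⟩
  have hinf := ι.centralizer_range_inf_range hι
  refine ⟨Subgroup.centralizer (ι.range : Set G), ?_, ?_, hinf, ?_, fun q => ⟨s q, hsC q, hs q⟩,
    ?_⟩
  · ext g
    constructor
    · intro hg
      obtain ⟨n, hn⟩ := hdecomp g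
      have hnC : ι n ∈ Subgroup.centralizer (ι.range : Set G) := by
        rw [eq_mul_inv_of_mul_eq hn.symm]
        exact mul_mem hg (inv_mem (hsC _))
      have hmap : ι n ∈ Subgroup.map ι (Subgroup.center N) := hinf ▸ ⟨hnC, n, rfl⟩
      exact ⟨n, (Subgroup.mem_map_iff_mem hι).mp hmap, π g, hn⟩
    · rintro ⟨z, hz, q, rfl⟩
      have hzC : ι z ∈ Subgroup.centralizer (ι.range : Set G) ⊓ ι.range :=
        hinf ▸ Subgroup.mem_map_of_mem ι hz
      exact mul_mem hzC.1 (hsC q)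
  · intro h hh n
    exact (Subgroup.mem_centralizer_iff.mp hh (ι n) ⟨n, rfl⟩).symm
  · intro g
    obtain ⟨n, hn⟩ := hdecomp g
    exact ⟨n, s (π g), hsC _, hn⟩
  · intro h hh
    rw [← hinf, Subgroup.mem_inf, hrk, MonoidHom.mem_ker]
    exact ⟨fun h1 => ⟨by rwa [← hrk], h1⟩, And.right⟩
end

section
/- Row-span criterion for cohomology-class isomorphism over ℤ_p^k. Let p be a prime, k ≥ 1, and Q a finite group. For j = 1,2 let f_j : Q × Q → (ℤ/p)^k be a normalized 2-cocycle for the trivial action, and let R_j be the ℤ/p-linear span, inside the vector space of all functions Q × Q → ℤ/p, of the k coordinate functions π_i ∘ f_j (i ∈ {1,…,k}). Then there exists α ∈ GL_k(ℤ/p) = Aut((ℤ/p)^k) such that f₁ − α ∘ f₂ is a normalized 2-coboundary in B²(Q,(ℤ/p)^k) if and only if R₁ + B²(Q, ℤ/p) = R₂ + B²(Q, ℤ/p) as subspaces of the space of functions Q × Q → ℤ/p. -/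
/-- `f : Q × Q → A` is a normalized `2`-coboundary (for the trivial action). -/
def IsNormalizedCoboundary {Q : Type} [Group Q] {A : Type} [AddCommGroup A]
    (f : Q → Q → A) : Prop :=
  ∃ u : Q → A, u 1 = 0 ∧ ∀ p q, f p q = u p + u q - u (p * q)

/-- `B²(Q, ℤ/p)` as a `ℤ/p`-subspace of the space of all functions `Q × Q → ℤ/p`. -/
def coboundarySubmodule (p : ℕ) (Q : Type) [Group Q] :
    Submodule (ZMod p) (Q → Q → ZMod p) where
  carrier := {f | IsNormalizedCoboundary f}
  add_mem' := by
    rintro f g ⟨u, hu0, hu⟩ ⟨v, hv0, hv⟩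
    refine ⟨u + v, by simp [hu0, hv0], fun a b => ?_⟩
    simp only [Pi.add_apply, hu, hv]
    abel
  zero_mem' := ⟨0, rfl, by simp⟩
  smul_mem' := by
    rintro c f ⟨u, hu0, hu⟩
    refine ⟨c • u, by simp [hu0], fun a b => ?_⟩
    simp only [Pi.smul_apply, hu, smul_add, smul_sub]

/-- Two linear maps out of a finite-dimensional space with the same range differ by an
automorphism of the source. -/
theorem LinearMap.exists_linearEquiv_comp_eq_of_range_eq {K E V : Type*} [Field K]
    [AddCommGroup E] [Module K E] [FiniteDimensional K E] [AddCommGroup V] [Module K V]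
    (F G : E →ₗ[K] V) (h : LinearMap.range F = LinearMap.range G) :
    ∃ σ : E ≃ₗ[K] E, ∀ x, G (σ x) = F x := by
  obtain ⟨C, hC⟩ := Submodule.exists_isCompl (LinearMap.ker F)
  obtain ⟨D, hD⟩ := Submodule.exists_isCompl (LinearMap.ker G)
  have hker : Module.finrank K (LinearMap.ker F) = Module.finrank K (LinearMap.ker G) := by
    have hF := F.finrank_range_add_finrank_ker
    have hG := G.finrank_range_add_finrank_ker
    rw [h] at hF
    omega
  let e := LinearEquiv.ofFinrankEq _ _ hker
  let eF := (Submodule.quotientEquivOfIsCompl _ C hC).symm ≪≫ₗ F.quotKerEquivRange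
  let eG := (Submodule.quotientEquivOfIsCompl _ D hD).symm ≪≫ₗ G.quotKerEquivRange
  have heF (c : C) : (eF c : V) = F c := by simp [eF]
  have heG (d : D) : (eG d : V) = G d := by simp [eG]
  let c := eF ≪≫ₗ LinearEquiv.ofEq _ _ h ≪≫ₗ eG.symm
  have hc (x : C) : G (c x) = F x := by
    rw [← heG, ← heF]
    simp [c]
  refine ⟨(Submodule.prodEquivOfIsCompl _ C hC).symm ≪≫ₗ e.prodCongr c ≪≫ₗ
    Submodule.prodEquivOfIsCompl _ D hD, fun x => ?_⟩
  obtain ⟨⟨a, b⟩, rfl⟩ := (Submodule.prodEquivOfIsCompl _ C hC).surjective x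
  have ha : F a = 0 := a.2
  have hea : G (e a) = 0 := (e a).2
  rw [LinearEquiv.trans_apply, LinearEquiv.trans_apply, LinearEquiv.symm_apply_apply]
  simp only [LinearEquiv.prodCongr_apply, Submodule.coe_prodEquivOfIsCompl', map_add, ha, hea, hc]

/-- A map into a power of `A` is a normalized coboundary iff each of its coordinates is. -/
theorem isNormalizedCoboundary_pi_iff {Q ι A : Type} [Group Q] [AddCommGroup A]
    {f : Q → Q → ι → A} :
    IsNormalizedCoboundary f ↔ ∀ i, IsNormalizedCoboundary fun a b => f a b i := by
  constructor
  · rintro ⟨u, hu1, hu⟩ i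
    exact ⟨fun q => u q i, by simp [hu1], fun a b => by simp [hu]⟩
  · intro h
    choose u hu1 hu using h
    exact ⟨fun q i => u i q, funext hu1, fun a b => funext fun i => hu i a b⟩

/-- Composing a normalized coboundary with an additive map gives a normalized coboundary. -/
theorem IsNormalizedCoboundary.map {Q A B : Type} [Group Q] [AddCommGroup A] [AddCommGroup B]
    {f : Q → Q → A} (hf : IsNormalizedCoboundary f) (φ : A →+ B) :
    IsNormalizedCoboundary fun a b => φ (f a b) := by
  obtain ⟨u, hu1, hu⟩ := hf
  exact ⟨fun q => φ (u q), by simp [hu1], fun a b => by simp [hu]⟩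

/-- If `f - φ ∘ g` is a normalized coboundary with `φ` linear, the coordinates of `f` lie in the
span of those of `g` modulo coboundaries. -/
theorem span_coord_sup_coboundary_le {p : ℕ} {Q ι κ : Type} [Group Q] [Fintype κ]
    {f : Q → Q → ι → ZMod p} {g : Q → Q → κ → ZMod p} (φ : (κ → ZMod p) →ₗ[ZMod p] (ι → ZMod p))
    (h : IsNormalizedCoboundary fun a b => f a b - φ (g a b)) :
    Submodule.span (ZMod p) (Set.range fun i => (fun a b : Q => f a b i))
        ⊔ coboundarySubmodule p Q
      ≤ Submodule.span (ZMod p) (Set.range fun j => (fun a b : Q => g a b j))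
        ⊔ coboundarySubmodule p Q := by
  classical
  refine sup_le (Submodule.span_le.2 ?_) le_sup_right
  rintro _ ⟨i, rfl⟩
  have hsplit : (fun a b => f a b i) =
      (∑ j, φ (Pi.single j 1) i • fun a b => g a b j) +
        fun a b => (f a b - φ (g a b)) i := by
    funext a b
    have hφ : φ (g a b) i = ∑ j, g a b j * φ (Pi.single j 1) i := by
      conv_lhs => rw [pi_eq_sum_univ' (g a b)]
      simp [Finset.sum_apply]
    simp [Finset.sum_apply, hφ, mul_comm]
  beta_reduce
  rw [SetLike.mem_coe, hsplit]
  exact Submodule.add_mem_sup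
    (Submodule.sum_mem _ fun j _ => Submodule.smul_mem _ _ (Submodule.subset_span ⟨j, rfl⟩))
    (isNormalizedCoboundary_pi_iff.1 h i)

/-- **Row-span criterion for cohomology-class isomorphism over `(ℤ/p)^k`.**
For normalized `2`-cocycles `f₁, f₂ : Q × Q → (ℤ/p)^k` (trivial action), with `Rⱼ` the
`ℤ/p`-span of the `k` coordinate functions of `fⱼ`, there exists
`α ∈ GL_k(ℤ/p) = Aut((ℤ/p)^k)` with `f₁ − α ∘ f₂` a normalized `2`-coboundary iff
`R₁ + B²(Q, ℤ/p) = R₂ + B²(Q, ℤ/p)`. -/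
theorem rowspan_criterion (p : ℕ) (hp : p.Prime) (k : ℕ) (hk : 1 ≤ k)
    (Q : Type) [Group Q] [Finite Q]
    (f₁ f₂ : Q → Q → (Fin k → ZMod p))
    (hnorm₁ : ∀ q, f₁ 1 q = 0 ∧ f₁ q 1 = 0)
    (hnorm₂ : ∀ q, f₂ 1 q = 0 ∧ f₂ q 1 = 0)
    (hcoc₁ : ∀ a b c, f₁ a b + f₁ (a * b) c = f₁ b c + f₁ a (b * c))
    (hcoc₂ : ∀ a b c, f₂ a b + f₂ (a * b) c = f₂ b c + f₂ a (b * c)) :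
    (∃ α : (Fin k → ZMod p) ≃ₗ[ZMod p] (Fin k → ZMod p),
        IsNormalizedCoboundary (fun a b => f₁ a b - α (f₂ a b))) ↔
      Submodule.span (ZMod p)
          (Set.range fun i : Fin k => (fun a b : Q => f₁ a b i))
          ⊔ coboundarySubmodule p Q
        = Submodule.span (ZMod p)
            (Set.range fun i : Fin k => (fun a b : Q => f₂ a b i))
            ⊔ coboundarySubmodule p Q := by
  have : Fact p.Prime := ⟨hp⟩
  constructor
  · rintro ⟨α, hα⟩
    refine le_antisymm (span_coord_sup_coboundary_le α.toLinearMap hα)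
      (span_coord_sup_coboundary_le α.symm.toLinearMap ?_)
    simpa using hα.map (-α.symm.toLinearMap).toAddMonoidHom
  · intro h
    let B := coboundarySubmodule p Q
    let L (f : Q → Q → Fin k → ZMod p) : (Fin k → ZMod p) →ₗ[ZMod p] (Q → Q → ZMod p) :=
      Fintype.linearCombination (ZMod p) fun i a b => f a b i
    have hrange (f : Q → Q → Fin k → ZMod p) : LinearMap.range (B.mkQ ∘ₗ L f) =
        (Submodule.span (ZMod p) (Set.range fun i => (fun a b : Q => f a b i)) ⊔ B).map B.mkQ := by
      rw [LinearMap.range_comp, Fintype.range_linearCombination, Submodule.map_sup,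
        Submodule.mkQ_map_self, sup_bot_eq]
    obtain ⟨σ, hσ⟩ := LinearMap.exists_linearEquiv_comp_eq_of_range_eq
      (B.mkQ ∘ₗ L f₁) (B.mkQ ∘ₗ L f₂) (by rw [hrange, hrange, h])
    let δ := dotProductEquiv (ZMod p) (Fin k)
    let α := δ ≪≫ₗ σ.dualMap ≪≫ₗ δ.symm
    have hα (y : Fin k → ZMod p) (i : Fin k) : α y i = y ⬝ᵥ σ (Pi.single i 1) := by
      simp [α, δ, dotProductEquiv]
    refine ⟨α, isNormalizedCoboundary_pi_iff.2 fun i => ?_⟩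
    have hmem : L f₁ (Pi.single i 1) - L f₂ (σ (Pi.single i 1)) ∈ B :=
      (Submodule.Quotient.eq B).1 (hσ (Pi.single i 1)).symm
    convert (show IsNormalizedCoboundary _ from hmem) using 1
    funext a b
    simp [L, hα, Fintype.linearCombination_apply, dotProduct, Finset.sum_apply, mul_comm,
      Pi.single_apply]
end

section
/- Sums of factorwise 2-cocycles over a direct product. Let I be a finite index set, let {T_i}_{i∈I} be groups, let Q = ∏_{i∈I} T_i be their direct product, and let A be an abelian group. For each i ∈ I, let f_i : T_i × T_i → A be a normalized 2-cocycle for the trivial action. Then the map f : Q × Q → A defined by f(p,q) = Σ_{i∈I} f_i(p_i, q_i) (where p_i, q_i denote the i-th coordinates of p, q) is a normalized 2-cocycle for the trivial action on Q; moreover, f is a normalized 2-coboundary if and only if every f_i is a normalized 2-coboundary. -/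
/-- **Sums of factorwise 2-cocycles over a direct product.** Let `Q = ∏ᵢ Tᵢ` (finite
index set) and, for each `i`, let `fᵢ : Tᵢ × Tᵢ → A` be a normalized `2`-cocycle for
the trivial action. Then `F (p, q) = Σᵢ fᵢ (pᵢ, qᵢ)` is a normalized `2`-cocycle for
the trivial action on `Q`, and `F` is a normalized `2`-coboundary iff every `fᵢ` is. -/
theorem factorwise_cocycle_sum
    (I : Type) [Fintype I] (T : I → Type) [∀ i, Group (T i)]
    (A : Type) [AddCommGroup A]
    (f : ∀ i, T i → T i → A)
    (hnorm : ∀ i (t : T i), f i 1 t = 0 ∧ f i t 1 = 0)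
    (hcoc : ∀ i (a b c : T i),
      f i a b + f i (a * b) c = f i b c + f i a (b * c)) :
    let F : (∀ i, T i) → (∀ i, T i) → A := fun pp qq => ∑ i, f i (pp i) (qq i)
    (∀ q : ∀ i, T i, F 1 q = 0 ∧ F q 1 = 0) ∧
    (∀ a b c : ∀ i, T i, F a b + F (a * b) c = F b c + F a (b * c)) ∧
    (IsNormalizedCoboundary F ↔ ∀ i, IsNormalizedCoboundary (f i)) := by
  intro F
  refine ⟨fun q => ⟨?_, ?_⟩, fun a b c => ?_, ?_, ?_⟩
  · exact Finset.sum_eq_zero fun i _ => (hnorm i (q i)).1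
  · exact Finset.sum_eq_zero fun i _ => (hnorm i (q i)).2
  · simp only [F, ← Finset.sum_add_distrib]
    exact Finset.sum_congr rfl fun i _ => hcoc i (a i) (b i) (c i)
  · rintro ⟨u, hu, h⟩ i
    classical
    refine ⟨fun t => u (Pi.mulSingle i t), by simpa using hu, fun p q => ?_⟩
    have hF : F (Pi.mulSingle i p) (Pi.mulSingle i q) = f i p q := by
      refine (Finset.sum_eq_single i (fun j _ hj => ?_) (by simp)).trans (by simp)
      simp [Pi.mulSingle_eq_of_ne hj, hnorm]
    rw [← hF, h, ← Pi.mulSingle_mul]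
  · intro h
    choose u hu h using h
    exact ⟨fun q => ∑ i, u i (q i), Finset.sum_eq_zero fun i _ => hu i,
      fun p q => by simp [F, h, Finset.sum_add_distrib, Finset.sum_sub_distrib]⟩
end

section
/- Equivalence of central extensions by a product of nonabelian simple groups is determined by the restrictions to the factors. Let A be an abelian group, let T₁,…,T_ℓ be finite nonabelian simple groups, and let Q = T₁ × … × T_ℓ. For j = 1,2, let G_j be a finite group given as an extension of A by Q via ι_j : A → G_j and π_j : G_j → Q, and assume the range of ι_j equals the center Z(G_j). For each i ∈ {1,…,ℓ}, identify T_i with the i-th coordinate subgroup of Q and let U_{j,i} = π_j⁻¹(T_i); then ι_j maps A into U_{j,i} and π_j restricts to a surjection U_{j,i} → T_i with kernel ι_j(A), so U_{j,i} is an extension of A by T_i. Then there exists a group isomorphism γ : G₁ → G₂ with γ ∘ ι₁ = ι₂ and π₂ ∘ γ = π₁ if and only if for every i ∈ {1,…,ℓ} there exists a group isomorphism γ_i : U_{1,i} → U_{2,i} with γ_i ∘ ι₁ = ι₂ and π₂ ∘ γ_i equal to the restriction of π₁ to U_{1,i}. -/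
/-- The `i`-th coordinate subgroup of a direct product `∏ j, T j`: elements that are
trivial in every coordinate other than `i`. -/
def coordSubgroup {ℓ : ℕ} (T : Fin ℓ → Type) [∀ j, Group (T j)] (i : Fin ℓ) :
    Subgroup (∀ j, T j) where
  carrier := {q | ∀ j, j ≠ i → q j = 1}
  one_mem' := fun _ _ => rfl
  mul_mem' := by
    intro a b ha hb j hj
    simp [ha j hj, hb j hj]
  inv_mem' := by
    intro a ha j hj
    simp [ha j hj]

theorem commutator_top_eq_top_of_isSimpleGroup {G : Type*} [Group G] [IsSimpleGroup G]
    (h : ∃ a b : G, a * b ≠ b * a) : ⁅(⊤ : Subgroup G), (⊤ : Subgroup G)⁆ = ⊤ := by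
  refine (Subgroup.Normal.eq_bot_or_eq_top inferInstance).resolve_left fun hbot => ?_
  obtain ⟨a, b, hab⟩ := h
  rw [Subgroup.commutator_top_left_eq_bot_iff_le_center] at hbot
  exact hab (Subgroup.mem_center_iff.mp (hbot (Subgroup.mem_top b)) a)

theorem map_mulSingle_top_eq_coordSubgroup {ℓ : ℕ} (T : Fin ℓ → Type) [∀ j, Group (T j)]
    (i : Fin ℓ) : (⊤ : Subgroup (T i)).map (MonoidHom.mulSingle T i) = coordSubgroup T i := by
  ext q
  simp only [Subgroup.mem_map, Subgroup.mem_top, true_and, MonoidHom.mulSingle_apply]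
  constructor
  · rintro ⟨t, rfl⟩ j hj
    exact Pi.mulSingle_eq_of_ne hj t
  · intro hq
    refine ⟨q i, funext fun j => ?_⟩
    obtain rfl | hj := eq_or_ne j i
    · exact Pi.mulSingle_eq_same j (q j)
    · rw [Pi.mulSingle_eq_of_ne hj, hq j hj]

theorem commutator_coordSubgroup {ℓ : ℕ} (T : Fin ℓ → Type) [∀ j, Group (T j)] (i : Fin ℓ)
    (hT : ⁅(⊤ : Subgroup (T i)), (⊤ : Subgroup (T i))⁆ = ⊤) :
    ⁅coordSubgroup T i, coordSubgroup T i⁆ = coordSubgroup T i := by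
  rw [← map_mulSingle_top_eq_coordSubgroup, ← Subgroup.map_commutator, hT]

theorem commutator_coordSubgroup_of_ne {ℓ : ℕ} (T : Fin ℓ → Type) [∀ j, Group (T j)]
    {i j : Fin ℓ} (hij : i ≠ j) : ⁅coordSubgroup T i, coordSubgroup T j⁆ = ⊥ := by
  rw [eq_bot_iff, Subgroup.commutator_le]
  intro x hx y hy
  refine Subgroup.mem_bot.mpr (commutatorElement_eq_one_iff_mul_comm.mpr (funext fun k => ?_))
  obtain rfl | hk := eq_or_ne k i
  · simp [hy k hij]
  · simp [hx k hk]

/-- In a central extension, a perfect subgroup of the quotient and any subgroup commuting with it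
have commuting preimages. -/
theorem commutator_comap_eq_bot {G Q : Type*} [Group G] [Group Q] {π : G →* Q}
    (hπ : Function.Surjective π) (hker : π.ker ≤ Subgroup.center G) {H K : Subgroup Q}
    (hH : ⁅H, H⁆ = H) (hHK : ⁅H, K⁆ = ⊥) : ⁅H.comap π, K.comap π⁆ = ⊥ := by
  have hcentral : ⁅H.comap π, K.comap π⁆ ≤ Subgroup.center G := by
    refine le_trans ?_ hker
    rw [← MonoidHom.comap_bot, ← Subgroup.map_le_iff_le_comap, Subgroup.map_commutator,
      Subgroup.map_comap_eq_self_of_surjective hπ, Subgroup.map_comap_eq_self_of_surjective hπ, hHK]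
  have hbot : ∀ L : Subgroup G, ⁅⁅H.comap π, K.comap π⁆, L⁆ = ⊥ := fun L =>
    Subgroup.commutator_eq_bot_iff_le_centralizer.mpr
      (hcentral.trans (Subgroup.center_le_centralizer _))
  have hderived : ⁅⁅H.comap π, H.comap π⁆, K.comap π⁆ = ⊥ :=
    Subgroup.commutator_commutator_eq_bot_of_rotate (hbot _)
      (by rw [Subgroup.commutator_comm (K.comap π)]; exact hbot _)
  rw [Subgroup.commutator_eq_bot_iff_le_centralizer] at hderived ⊢
  have hmap : (⁅H.comap π, H.comap π⁆).map π = H := by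
    rw [Subgroup.map_commutator, Subgroup.map_comap_eq_self_of_surjective hπ, hH]
  calc H.comap π = ⁅H.comap π, H.comap π⁆ ⊔ π.ker := by
        rw [← Subgroup.comap_map_eq, hmap]
    _ ≤ _ := sup_le hderived (hker.trans (Subgroup.center_le_centralizer _))

theorem commute_of_mem_coordSubgroup {ℓ : ℕ} {T : Fin ℓ → Type} [∀ j, Group (T j)]
    (hT : ∀ i, ⁅(⊤ : Subgroup (T i)), (⊤ : Subgroup (T i))⁆ = ⊤)
    {G : Type*} [Group G] {π : G →* ∀ j, T j} (hπ : Function.Surjective π)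
    (hker : π.ker ≤ Subgroup.center G) {i j : Fin ℓ} (hij : i ≠ j) {x y : G}
    (hx : π x ∈ coordSubgroup T i) (hy : π y ∈ coordSubgroup T j) : Commute x y := by
  have h := commutator_comap_eq_bot hπ hker (commutator_coordSubgroup T i (hT i))
    (commutator_coordSubgroup_of_ne T hij)
  rw [Subgroup.commutator_eq_bot_iff_le_centralizer] at h
  exact (Subgroup.mem_centralizer_iff.mp (h hx) y hy).symm

theorem MonoidHom.noncommPiCoprod_eq_map_prod {ι : Type*} [Fintype ι] {N : ι → Type*}
    [∀ i, Monoid (N i)] {A M : Type*} [CommMonoid A] [Monoid M] (φ : ∀ i, N i →* M)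
    (hcomm : Pairwise fun i j => ∀ x y, Commute (φ i x) (φ j y)) (f : A →* M) (a : ι → A)
    (u : ∀ i, N i) (h : ∀ i, φ i (u i) = f (a i)) :
    MonoidHom.noncommPiCoprod φ hcomm u = f (∏ i, a i) := by
  rw [MonoidHom.noncommPiCoprod_apply, ← Finset.noncommProd_eq_prod]
  exact (Finset.noncommProd_congr rfl (fun i _ => h i) _).trans
    (Finset.map_noncommProd Finset.univ a (fun _ _ _ _ _ => Commute.all _ _) f).symm

theorem map_noncommPiCoprod_apply {ℓ : ℕ} {T : Fin ℓ → Type} [∀ j, Group (T j)]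
    {N : Fin ℓ → Type*} [∀ i, Group (N i)] {G : Type*} [Group G] (π : G →* ∀ j, T j)
    (φ : ∀ i, N i →* G) (hcomm : Pairwise fun i j => ∀ x y, Commute (φ i x) (φ j y))
    (hφ : ∀ i x, π (φ i x) ∈ coordSubgroup T i) (u : ∀ i, N i) (i : Fin ℓ) :
    π (MonoidHom.noncommPiCoprod φ hcomm u) i = π (φ i (u i)) i := by
  suffices h : ((Pi.evalMonoidHom T i).comp π).comp (MonoidHom.noncommPiCoprod φ hcomm) =
      (((Pi.evalMonoidHom T i).comp π).comp (φ i)).comp (Pi.evalMonoidHom N i) from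
    DFunLike.congr_fun h u
  refine MonoidHom.pi_ext fun j y => ?_
  simp only [MonoidHom.comp_apply, MonoidHom.noncommPiCoprod_mulSingle, Pi.evalMonoidHom_apply]
  obtain rfl | hij := eq_or_ne i j
  · rw [Pi.mulSingle_eq_same]
  · rw [Pi.mulSingle_eq_of_ne hij, map_one, map_one, hφ j y i hij, Pi.one_apply]

/-- The short five lemma for groups. -/
theorem bijective_of_extension_hom {A Q G₁ G₂ : Type*} [Group A] [Group Q] [Group G₁] [Group G₂]
    {ι₁ : A →* G₁} {ι₂ : A →* G₂} {π₁ : G₁ →* Q} {π₂ : G₂ →* Q} (hι₂ : Function.Injective ι₂)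
    (hπ₁ : Function.Surjective π₁) (h₁ : ι₁.range = π₁.ker) (h₂ : ι₂.range = π₂.ker)
    (γ : G₁ →* G₂) (hγι : ∀ a, γ (ι₁ a) = ι₂ a) (hγπ : ∀ g, π₂ (γ g) = π₁ g) :
    Function.Bijective γ := by
  constructor
  · refine (injective_iff_map_eq_one γ).mpr fun g hg => ?_
    have hker : g ∈ π₁.ker := by rw [MonoidHom.mem_ker, ← hγπ, hg, map_one]
    rw [← h₁] at hker
    obtain ⟨a, rfl⟩ := hker
    rw [hγι] at hg
    rw [(injective_iff_map_eq_one ι₂).mp hι₂ a hg, map_one]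
  · intro h
    obtain ⟨g, hg⟩ := hπ₁ (π₂ h)
    have hker : (γ g)⁻¹ * h ∈ π₂.ker := by
      rw [MonoidHom.mem_ker, map_mul, map_inv, hγπ, hg, inv_mul_cancel]
    rw [← h₂] at hker
    obtain ⟨a, ha⟩ := hker
    exact ⟨g * ι₁ a, by rw [map_mul, hγι, ha, mul_inv_cancel_left]⟩

theorem exists_monoidHom_comp_eq_of_ker_le {P G₁ G₂ : Type*} [Group P] [Group G₁] [Group G₂]
    {Φ₁ : P →* G₁} {Φ₂ : P →* G₂} (hΦ₁ : Function.Surjective Φ₁) (hker : Φ₁.ker ≤ Φ₂.ker) :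
    ∃ γ : G₁ →* G₂, ∀ p, γ (Φ₁ p) = Φ₂ p :=
  ⟨Φ₁.liftOfSurjective hΦ₁ ⟨Φ₂, hker⟩, fun p =>
    Φ₁.liftOfRightInverse_comp_apply _ (Function.rightInverse_surjInv hΦ₁) ⟨Φ₂, hker⟩ p⟩

/-- Compatible homomorphisms on the preimages of the factors of a product of perfect groups glue
to a homomorphism of central extensions. -/
theorem exists_extension_hom_of_restrictions {A : Type*} [CommGroup A] {ℓ : ℕ}
    {T : Fin ℓ → Type} [∀ j, Group (T j)]
    (hT : ∀ i, ⁅(⊤ : Subgroup (T i)), (⊤ : Subgroup (T i))⁆ = ⊤)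
    {G₁ G₂ : Type*} [Group G₁] [Group G₂] {ι₁ : A →* G₁} {ι₂ : A →* G₂}
    {π₁ : G₁ →* ∀ j, T j} {π₂ : G₂ →* ∀ j, T j}
    (hπ₁ : Function.Surjective π₁) (hπ₂ : Function.Surjective π₂)
    (h₁ : ι₁.range = π₁.ker) (h₂ : ι₂.range = π₂.ker) (hι₁ : Function.Injective ι₁)
    (hc₁ : ι₁.range ≤ Subgroup.center G₁) (hc₂ : ι₂.range ≤ Subgroup.center G₂)
    (φ : ∀ i, ↥((coordSubgroup T i).comap π₁) →* G₂)
    (hφι : ∀ i a (u : ↥((coordSubgroup T i).comap π₁)), (u : G₁) = ι₁ a → φ i u = ι₂ a)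
    (hφπ : ∀ i u, π₂ (φ i u) = π₁ u) :
    ∃ γ : G₁ →* G₂, (∀ a, γ (ι₁ a) = ι₂ a) ∧ ∀ g, π₂ (γ g) = π₁ g := by
  have hπι₁ : ∀ a, π₁ (ι₁ a) = 1 := fun a => MonoidHom.mem_ker.mp (h₁ ▸ ⟨a, rfl⟩)
  have hπι₂ : ∀ a, π₂ (ι₂ a) = 1 := fun a => MonoidHom.mem_ker.mp (h₂ ▸ ⟨a, rfl⟩)
  let ψ : ∀ i, ↥((coordSubgroup T i).comap π₁) →* G₁ := fun i => Subgroup.subtype _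
  have hψ : ∀ i x, π₁ (ψ i x) ∈ coordSubgroup T i := fun i x => x.2
  have hφ : ∀ i x, π₂ (φ i x) ∈ coordSubgroup T i := fun i x => by rw [hφπ]; exact x.2
  have hcψ : Pairwise fun i j => ∀ x y, Commute (ψ i x) (ψ j y) := fun i j hij x y =>
    commute_of_mem_coordSubgroup hT hπ₁ (h₁ ▸ hc₁) hij (hψ i x) (hψ j y)
  have hcφ : Pairwise fun i j => ∀ x y, Commute (φ i x) (φ j y) := fun i j hij x y =>
    commute_of_mem_coordSubgroup hT hπ₂ (h₂ ▸ hc₂) hij (hφ i x) (hφ j y)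
  let Ψ := MonoidHom.noncommPiCoprod ψ hcψ
  let Φ := MonoidHom.noncommPiCoprod φ hcφ
  have hΨπ : ∀ u i, π₁ (Ψ u) i = π₁ (u i) i := map_noncommPiCoprod_apply π₁ ψ hcψ hψ
  have hΦπ : ∀ u, π₂ (Φ u) = π₁ (Ψ u) := fun u => funext fun i => by
    rw [hΨπ, map_noncommPiCoprod_apply π₂ φ hcφ hφ, hφπ]
  let Ψ' := ι₁.noncommCoprod Ψ fun a u => (Subgroup.mem_center_iff.mp (hc₁ ⟨a, rfl⟩) (Ψ u)).symm
  let Φ' := ι₂.noncommCoprod Φ fun a u => (Subgroup.mem_center_iff.mp (hc₂ ⟨a, rfl⟩) (Φ u)).symm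
  have hΨ' : ∀ a u, Ψ' (a, u) = ι₁ a * Ψ u := fun a u => rfl
  have hΦ' : ∀ a u, Φ' (a, u) = ι₂ a * Φ u := fun a u => rfl
  have hsurj : Function.Surjective Ψ' := by
    intro g
    choose v hv using fun i => hπ₁ (Pi.mulSingle i (π₁ g i))
    have hvmem : ∀ i, π₁ (v i) ∈ coordSubgroup T i := fun i j hj => by
      rw [hv, Pi.mulSingle_eq_of_ne hj]
    let u : ∀ i, ↥((coordSubgroup T i).comap π₁) := fun i => ⟨v i, hvmem i⟩
    have hu : π₁ (Ψ u) = π₁ g := funext fun i => by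
      rw [hΨπ, hv, Pi.mulSingle_eq_same]
    have hmem : g * (Ψ u)⁻¹ ∈ π₁.ker := by
      rw [MonoidHom.mem_ker, map_mul, map_inv, hu, mul_inv_cancel]
    rw [← h₁] at hmem
    obtain ⟨a, ha⟩ := hmem
    exact ⟨(a, u), by rw [hΨ', ha, inv_mul_cancel_right]⟩
  have hker : Ψ'.ker ≤ Φ'.ker := by
    rintro ⟨a, u⟩ hau
    rw [MonoidHom.mem_ker, hΨ'] at hau
    rw [MonoidHom.mem_ker, hΦ']
    have hπu : π₁ (Ψ u) = 1 := by
      simpa [hπι₁] using congrArg π₁ hau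
    have hu : ∀ i, (u i : G₁) ∈ ι₁.range := fun i => by
      rw [h₁, MonoidHom.mem_ker]
      funext j
      obtain rfl | hj := eq_or_ne j i
      · rw [← hΨπ, hπu]
      · exact (u i).2 j hj
    choose b hb using hu
    have hΨu : Ψ u = ι₁ (∏ i, b i) :=
      MonoidHom.noncommPiCoprod_eq_map_prod ψ hcψ ι₁ b u fun i => (hb i).symm
    have hΦu : Φ u = ι₂ (∏ i, b i) :=
      MonoidHom.noncommPiCoprod_eq_map_prod φ hcφ ι₂ b u fun i => hφι i _ _ (hb i).symm
    rw [hΨu, ← map_mul] at hau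
    rw [hΦu, ← map_mul, (injective_iff_map_eq_one ι₁).mp hι₁ _ hau, map_one]
  obtain ⟨γ, hγ⟩ := exists_monoidHom_comp_eq_of_ker_le hsurj hker
  refine ⟨γ, fun a => ?_, fun g => ?_⟩
  · simpa [hΨ', hΦ'] using hγ (a, 1)
  · obtain ⟨⟨a, u⟩, rfl⟩ := hsurj g
    rw [hγ, hΨ', hΦ', map_mul, map_mul, hπι₁, hπι₂, hΦπ]

/-- **Equivalence of central extensions by a product of nonabelian simple groups is
determined by the restrictions to the factors.** Let `Q = T₁ × … × T_ℓ` with each `Tᵢ`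
finite nonabelian simple, and for `j = 1, 2` let `Gⱼ` be a central extension of `A`
by `Q` (via `ιⱼ, πⱼ`) with `ιⱼ(A) = Z(Gⱼ)`. Let `U_{j,i} = πⱼ⁻¹(Tᵢ)`. Then the two
extensions are equivalent iff for every `i` the restricted extensions `U_{1,i}` and
`U_{2,i}` of `A` by `Tᵢ` are equivalent. -/
theorem central_extension_by_product_of_simples_restriction
    (A : Type) [CommGroup A]
    (ℓ : ℕ) (T : Fin ℓ → Type) [∀ j, Group (T j)] [∀ j, Finite (T j)]
    (hsimple : ∀ j, IsSimpleGroup (T j))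
    (hnonab : ∀ j, ∃ a b : T j, a * b ≠ b * a)
    (G₁ G₂ : Type) [Group G₁] [Group G₂] [Finite G₁] [Finite G₂]
    (ι₁ : A →* G₁) (ι₂ : A →* G₂)
    (π₁ : G₁ →* (∀ j, T j)) (π₂ : G₂ →* (∀ j, T j))
    (hι₁ : Function.Injective ι₁) (hι₂ : Function.Injective ι₂)
    (hπ₁ : Function.Surjective π₁) (hπ₂ : Function.Surjective π₂)
    (hrk₁ : ι₁.range = π₁.ker) (hrk₂ : ι₂.range = π₂.ker)
    (hc₁ : ι₁.range = Subgroup.center G₁) (hc₂ : ι₂.range = Subgroup.center G₂) :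
    (∃ γ : G₁ ≃* G₂, (∀ a, γ (ι₁ a) = ι₂ a) ∧ ∀ g, π₂ (γ g) = π₁ g) ↔
      ∀ i : Fin ℓ,
        ∃ γi : ↥(Subgroup.comap π₁ (coordSubgroup T i)) ≃*
            ↥(Subgroup.comap π₂ (coordSubgroup T i)),
          (∀ a : A,
            (γi ⟨ι₁ a, by
                have h1 : π₁ (ι₁ a) = 1 := by
                  have : ι₁ a ∈ π₁.ker := hrk₁ ▸ MonoidHom.mem_range.mpr ⟨a, rfl⟩
                  exact this
                exact Subgroup.mem_comap.mpr
                  (by rw [h1]; exact (coordSubgroup T i).one_mem)⟩ : G₂)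
              = ι₂ a) ∧
          (∀ x : ↥(Subgroup.comap π₁ (coordSubgroup T i)),
            π₂ ((γi x : G₂)) = π₁ (x : G₁)) := by
  constructor
  · rintro ⟨γ, hγι, hγπ⟩ i
    have hmap : ((coordSubgroup T i).comap π₁).map (γ : G₁ →* G₂) =
        (coordSubgroup T i).comap π₂ := by
      ext h
      simp only [Subgroup.mem_map, Subgroup.mem_comap, MonoidHom.coe_coe]
      constructor
      · rintro ⟨g, hg, rfl⟩
        rwa [hγπ]
      · intro hh
        exact ⟨γ.symm h, by rwa [← hγπ, γ.apply_symm_apply], γ.apply_symm_apply h⟩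
    exact ⟨(γ.subgroupMap _).trans (MulEquiv.subgroupCongr hmap), hγι, fun x => hγπ x⟩
  · intro h
    choose γ' hγι hγπ using h
    have hT : ∀ i, ⁅(⊤ : Subgroup (T i)), (⊤ : Subgroup (T i))⁆ = ⊤ := fun i =>
      have := hsimple i
      commutator_top_eq_top_of_isSimpleGroup (hnonab i)
    obtain ⟨γ, hι, hπ⟩ := exists_extension_hom_of_restrictions hT hπ₁ hπ₂
      hrk₁ hrk₂ hι₁ hc₁.le hc₂.le
      (fun i => (Subgroup.subtype _).comp (γ' i).toMonoidHom)
      (fun i a u hu => by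
        rw [← hγι i a]
        exact congrArg (fun x => (γ' i x : G₂)) (Subtype.ext hu))
      hγπ
    exact ⟨MulEquiv.ofBijective γ (bijective_of_extension_hom hι₂ hπ₁ hrk₁ hrk₂ γ hι hπ), hι, hπ⟩
end

section
/- Splitting off a central direct factor. Let Q be a group, let A′ and A″ be abelian groups, and let f : Q × Q → A′ × A″ be a normalized 2-cocycle for the trivial action such that the first-component map p_{A′} ∘ f : Q × Q → A′ is a normalized 2-coboundary, where p_{A′} : A′ × A″ → A′ is the projection. Let G = H(f) be the reconstruction group on the set (A′ × A″) × Q with multiplication (x,p)∘(y,q) = (x + y + f(p,q), pq). Then the subgroup P = { ((a,0), 1) : a ∈ A′ } is central in G, and there exists a normal subgroup K of G with P ∩ K trivial and P·K = G; consequently G is isomorphic to the direct product A′ × (G / P). -/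
/-- The reconstruction group `H(f)` of a normalized `2`-cocycle `f : Q × Q → A` for the
trivial action: the set `A × Q` with multiplication `(a,p)∘(b,q) = (a + b + f p q, pq)`. -/
def recGroup (Q : Type) [Group Q] (A : Type) [AddCommGroup A]
    (f : Q → Q → A)
    (h1 : ∀ q, f 1 q = 0) (h2 : ∀ q, f q 1 = 0)
    (hcoc : ∀ p q r, f p q + f (p * q) r = f q r + f p (q * r)) :
    Group (A × Q) where
  mul x y := (x.1 + y.1 + f x.2 y.2, x.2 * y.2)
  one := (0, 1)
  inv x := (-x.1 - f x.2⁻¹ x.2, x.2⁻¹)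
  mul_assoc a b c := by
    refine Prod.ext ?_ ?_
    · show a.1 + b.1 + f a.2 b.2 + c.1 + f (a.2 * b.2) c.2
        = a.1 + (b.1 + c.1 + f b.2 c.2) + f a.2 (b.2 * c.2)
      have h := hcoc a.2 b.2 c.2
      calc a.1 + b.1 + f a.2 b.2 + c.1 + f (a.2 * b.2) c.2
          = a.1 + b.1 + c.1 + (f a.2 b.2 + f (a.2 * b.2) c.2) := by abel
        _ = a.1 + b.1 + c.1 + (f b.2 c.2 + f a.2 (b.2 * c.2)) := by rw [h]
        _ = a.1 + (b.1 + c.1 + f b.2 c.2) + f a.2 (b.2 * c.2) := by abel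
    · exact mul_assoc a.2 b.2 c.2
  one_mul a := by
    refine Prod.ext ?_ ?_
    · show 0 + a.1 + f 1 a.2 = a.1
      simp [h1]
    · exact one_mul a.2
  mul_one a := by
    refine Prod.ext ?_ ?_
    · show a.1 + 0 + f a.2 1 = a.1
      simp [h2]
    · exact mul_one a.2
  inv_mul_cancel a := by
    refine Prod.ext ?_ ?_
    · show -a.1 - f a.2⁻¹ a.2 + a.1 + f a.2⁻¹ a.2 = 0
      abel
    · exact inv_mul_cancel a.2

section CentralRetract

variable {G A : Type*} [Group G] [Group A] (s : A →* G) (φ : G →* A)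

/-- The kernel of a retraction `φ` of `s` meets the image of `s` trivially. -/
theorem range_inf_ker_eq_bot_of_leftInverse (h : Function.LeftInverse φ s) :
    s.range ⊓ φ.ker = ⊥ := by
  rw [eq_bot_iff]
  rintro _ ⟨⟨a, rfl⟩, ha⟩
  have ha' : a = 1 := by simpa [MonoidHom.mem_ker, h a] using ha
  simp [ha']

/-- The image of `s` and the kernel of a retraction `φ` of `s` generate the whole group. -/
theorem exists_range_mul_ker_of_leftInverse (h : Function.LeftInverse φ s) (g : G) :
    ∃ x ∈ s.range, ∃ y ∈ φ.ker, g = x * y :=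
  ⟨s (φ g), ⟨φ g, rfl⟩, (s (φ g))⁻¹ * g, by simp [MonoidHom.mem_ker, h (φ g)], by simp⟩

/-- If the image of `s` is normal and `φ` is a retraction of `s`, then `G` is the direct product
of `A` and the quotient of `G` by the image of `s`. -/
theorem bijective_prod_mk'_of_leftInverse [s.range.Normal] (h : Function.LeftInverse φ s) :
    Function.Bijective (φ.prod (QuotientGroup.mk' s.range)) := by
  constructor
  · rw [injective_iff_map_eq_one]
    intro g hg
    obtain ⟨hφ, hmk⟩ := Prod.ext_iff.mp hg
    have hmem : g ∈ s.range ⊓ φ.ker := ⟨(QuotientGroup.eq_one_iff g).mp hmk, hφ⟩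
    rwa [range_inf_ker_eq_bot_of_leftInverse s φ h, Subgroup.mem_bot] at hmem
  · rintro ⟨a, q⟩
    obtain ⟨g, rfl⟩ := QuotientGroup.mk'_surjective s.range q
    refine ⟨g * s ((φ g)⁻¹ * a), Prod.ext ?_ ?_⟩
    · simp [h a, h (φ g)]
    · exact QuotientGroup.mk_mul_of_mem g ⟨_, rfl⟩

end CentralRetract

/-- **Splitting off a central direct factor.** Let `f : Q × Q → A′ × A″` be a
normalized `2`-cocycle for the trivial action whose first component is a normalized
`2`-coboundary, and let `G = H(f)` be the reconstruction group. Then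
`P = {((a,0),1) : a ∈ A′}` is central in `G` and has a normal complement `K`
(`P ⊓ K = ⊥` and `P·K = G`); consequently `G ≅ A′ × (G/P)`. -/
theorem split_central_direct_factor
    (Q : Type) [Group Q] (A' A'' : Type) [AddCommGroup A'] [AddCommGroup A'']
    (f : Q → Q → A' × A'')
    (h1 : ∀ q, f 1 q = 0) (h2 : ∀ q, f q 1 = 0)
    (hcoc : ∀ p q r, f p q + f (p * q) r = f q r + f p (q * r))
    (hcb : ∃ u : Q → A', u 1 = 0 ∧ ∀ p q, (f p q).1 = u p + u q - u (p * q))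
    [inst : Group ((A' × A'') × Q)]
    (hinst : inst = recGroup Q (A' × A'') f h1 h2 hcoc) :
    ∃ P : Subgroup ((A' × A'') × Q),
      ((P : Set ((A' × A'') × Q)) = {x | ∃ a : A', x = (((a, 0) : A' × A''), (1 : Q))}) ∧
      P ≤ Subgroup.center ((A' × A'') × Q) ∧
      (∃ K : Subgroup ((A' × A'') × Q), K.Normal ∧ P ⊓ K = ⊥ ∧
        ∀ g : (A' × A'') × Q, ∃ x ∈ P, ∃ y ∈ K, g = x * y) ∧
      ∃ hP : P.Normal,
        Nonempty (haveI := hP;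
          ((A' × A'') × Q) ≃* Multiplicative A' × (((A' × A'') × Q) ⧸ P)) := by
  subst hinst
  let := recGroup Q (A' × A'') f h1 h2 hcoc
  obtain ⟨u, hu1, hu⟩ := hcb
  have mul_def : ∀ x y : (A' × A'') × Q, x * y = (x.1 + y.1 + f x.2 y.2, x.2 * y.2) :=
    fun _ _ => rfl
  let s : Multiplicative A' →* (A' × A'') × Q := MonoidHom.mk' (fun a => ((a.toAdd, 0), 1))
    fun a b => by simp [mul_def, h1]
  let φ : (A' × A'') × Q →* Multiplicative A' :=
    MonoidHom.mk' (fun x => Multiplicative.ofAdd (x.1.1 + u x.2)) fun x y => by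
      rw [mul_def, ← ofAdd_add]
      congr 1
      simp only [Prod.fst_add, hu]
      abel
  have hφs : Function.LeftInverse φ s := fun a => by simp [φ, s, hu1]
  have hcentral : s.range ≤ Subgroup.center ((A' × A'') × Q) := by
    rintro _ ⟨a, rfl⟩
    rw [Subgroup.mem_center_iff]
    intro g
    simp [s, mul_def, h1, h2, add_comm]
  have hnormal : s.range.Normal := ⟨fun n hn g => by
    rwa [Subgroup.mem_center_iff.mp (hcentral hn) g, mul_inv_cancel_right]⟩
  refine ⟨s.range, ?_, hcentral, ⟨φ.ker, inferInstance,
    range_inf_ker_eq_bot_of_leftInverse s φ hφs, exists_range_mul_ker_of_leftInverse s φ hφs⟩,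
    hnormal, ⟨MulEquiv.ofBijective _ (bijective_prod_mk'_of_leftInverse s φ hφs)⟩⟩
  ext x
  exact ⟨fun ⟨a, ha⟩ => ⟨a.toAdd, ha.symm⟩, fun ⟨a, ha⟩ => ⟨Multiplicative.ofAdd a, ha.symm⟩⟩
end
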